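/- arXiv:1703.07417 — 2 statements merged into one kernel-verified Lean document; each statement's English description precedes it below -/
import Mathlib

section
/- There exists a universal constant c > 0 with the following property: for every finite connected simple graph G = (V,E) on n ≥ 2 vertices, every integer k ≥ 1, and every real ε with 0 < ε ≤ 1, there exists a finitely supported probability distribution μ over partitions of V such that (1) for every partition P in the support of μ, every cluster C ∈ P, and all vertices u, w ∈ C, one has d_G(u,w) ≤ c·(k/ε)·log n; and (2) for every vertex u ∈ V, the probability under μ that the sampled partition contains a cluster C with B(u,k) ⊆ C is at least 1 − ε. -/
open Classical in
/-- Colour the ball of radius `r` around `v` with `v`, and keep the colouring `g` elsewhere. -/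
noncomputable def SimpleGraph.carve {V : Type} (G : SimpleGraph V) (v : V) (r : ℕ)
    (g : V → Option V) (w : V) : Option V :=
  if G.dist v w ≤ r then some v else g w

/-- The ball of radius `k` around `u` meets at least two colour classes of `f`. -/
def SimpleGraph.IsCut {V α : Type} (G : SimpleGraph V) (k : ℕ) (f : V → α) (u : V) : Prop :=
  ∃ w, G.dist u w ≤ k ∧ f w ≠ f u

theorem SimpleGraph.not_isCut_carve_of_add_le {V : Type} {G : SimpleGraph V} (hG : G.Connected)
    {v u : V} {k r : ℕ} {g : V → Option V} (h : G.dist v u + k ≤ r) :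
    ¬ G.IsCut k (G.carve v r g) u := by
  rintro ⟨w, hw, hne⟩
  have := hG.dist_triangle (u := v) (v := u) (w := w)
  refine hne ?_
  simp only [carve]
  rw [if_pos (by omega), if_pos (by omega)]

theorem SimpleGraph.IsCut.of_carve {V : Type} {G : SimpleGraph V} (hG : G.Connected)
    {v u : V} {k r : ℕ} {g : V → Option V} (h : r + k < G.dist v u)
    (hcut : G.IsCut k (G.carve v r g) u) : G.IsCut k g u := by
  obtain ⟨w, hw, hne⟩ := hcut
  refine ⟨w, hw, ?_⟩
  have := hG.dist_triangle (u := v) (v := w) (w := u)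
  rw [G.dist_comm (u := w)] at this
  simp only [carve] at hne
  rwa [if_neg (by omega), if_neg (by omega)] at hne

/-- Tail `m ↦ ℙ(R ≥ m)` of the geometric law of ratio `q` truncated at `M`. -/
def truncTail (q : ℝ) (M m : ℕ) : ℝ := if m ≤ M then q ^ m else 0

theorem truncTail_nonneg {q : ℝ} (h0 : 0 ≤ q) (M m : ℕ) : 0 ≤ truncTail q M m := by
  unfold truncTail; split_ifs <;> positivity

theorem truncTail_le_one {q : ℝ} (h0 : 0 ≤ q) (h1 : q ≤ 1) (M m : ℕ) :
    truncTail q M m ≤ 1 := by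
  unfold truncTail
  split_ifs
  · exact pow_le_one₀ h0 h1
  · exact zero_le_one

theorem truncTail_succ_le {q : ℝ} (h0 : 0 ≤ q) (h1 : q ≤ 1) (M m : ℕ) :
    truncTail q M (m + 1) ≤ truncTail q M m := by
  unfold truncTail
  split_ifs
  · exact pow_le_pow_of_le_one h0 h1 (by omega)
  · omega
  · positivity
  · exact le_rfl

theorem sum_truncTail_sub_lt (q : ℝ) (M A : ℕ) :
    ∑ r : Fin (M + 1), (truncTail q M r - truncTail q M (r + 1)) * (if (r : ℕ) < A then 1 else 0)
      = 1 - truncTail q M A := by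
  rw [Fin.sum_univ_eq_sum_range
    (fun r => (truncTail q M r - truncTail q M (r + 1)) * (if r < A then 1 else 0)) (M + 1)]
  have key (n : ℕ) : ∑ r ∈ Finset.range n,
      (truncTail q M r - truncTail q M (r + 1)) * (if r < A then 1 else 0)
        = 1 - truncTail q M (min A n) := by
    induction n with
    | zero => simp [truncTail]
    | succ n ih =>
      rw [Finset.sum_range_succ, ih]
      by_cases h : n < A
      · rw [if_pos h, min_eq_right h.le, min_eq_right (by omega : n + 1 ≤ A)]; ring
      · rw [if_neg h, min_eq_left (by omega), min_eq_left (by omega)]; ring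
  rw [key]
  rcases le_total A (M + 1) with h | h
  · rw [min_eq_left h]
  · rw [min_eq_right h]
    unfold truncTail
    by_cases hA : A ≤ M
    · omega
    · simp [hA]

theorem sum_truncTail_sub (q : ℝ) (M : ℕ) :
    ∑ r : Fin (M + 1), (truncTail q M r - truncTail q M (r + 1)) = 1 := by
  have h := sum_truncTail_sub_lt q M (M + 1)
  have h_top : truncTail q M (M + 1) = 0 := if_neg (by omega)
  simpa only [Fin.is_lt, if_true, mul_one, h_top, sub_zero] using h

theorem truncTail_sub_le {q : ℝ} (h0 : 0 ≤ q) (h1 : q ≤ 1) {N k d : ℕ} :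
    truncTail q (N + 2 * k) (d - k) - truncTail q (N + 2 * k) (d + k)
      ≤ (1 - q ^ (2 * k)) * truncTail q (N + 2 * k) (d - k) + q ^ N := by
  have hN : 0 ≤ q ^ N := by positivity
  by_cases hB : d + k ≤ N + 2 * k
  · have hA : d - k ≤ N + 2 * k := by omega
    simp only [truncTail, if_pos hA, if_pos hB]
    have : q ^ (2 * k + (d - k)) ≤ q ^ (d + k) := pow_le_pow_of_le_one h0 h1 (by omega)
    rw [pow_add] at this
    linarith
  · have hT := truncTail_nonneg h0 (N + 2 * k) (d - k)
    have hle : truncTail q (N + 2 * k) (d - k) ≤ q ^ N := by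
      unfold truncTail
      split_ifs
      · exact pow_le_pow_of_le_one h0 h1 (by omega)
      · exact hN
    have hq : q ^ (2 * k) ≤ 1 := pow_le_one₀ h0 h1
    have hB0 : truncTail q (N + 2 * k) (d + k) = 0 := if_neg hB
    rw [hB0]
    nlinarith [mul_nonneg (sub_nonneg.2 hq) hT]

open Classical in
/-- Ball carving with independent truncated geometric radii around the vertices of `s`. -/
theorem SimpleGraph.exists_random_carving {V : Type} {G : SimpleGraph V} (hG : G.Connected)
    {q : ℝ} (h0 : 0 ≤ q) (h1 : q ≤ 1) (N k : ℕ) (s : Finset V) :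
    ∃ (Ω : Type) (_ : Fintype Ω) (p : Ω → ℝ) (F : Ω → V → Option V),
      (∀ ω, 0 ≤ p ω) ∧ ∑ ω, p ω = 1 ∧
      (∀ ω v w, F ω w = some v → G.dist v w ≤ N + 2 * k) ∧
      (∀ ω, ∀ v ∈ s, F ω v ≠ none) ∧
      ∀ u, ∑ ω, p ω * (if G.IsCut k (F ω) u then 1 else 0)
        ≤ (1 - q ^ (2 * k)) + s.card * q ^ N := by
  have ha : 0 ≤ 1 - q ^ (2 * k) := sub_nonneg.2 (pow_le_one₀ h0 h1)
  have hb : 0 ≤ q ^ N := by positivity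
  induction s using Finset.induction_on with
  | empty =>
    refine ⟨Unit, inferInstance, fun _ => 1, fun _ _ => none, by simp, by simp, by simp, by simp,
      fun u => ?_⟩
    simpa [IsCut] using ha
  | insert v s hv ih =>
    obtain ⟨Ω, _, p, F, hp, hsum, hdist, hcov, hcut⟩ := ih
    set M := N + 2 * k with hM
    set t : ℕ → ℝ := fun r => truncTail q M r - truncTail q M (r + 1) with ht
    have ht0 (r : ℕ) : 0 ≤ t r := sub_nonneg.2 (truncTail_succ_le h0 h1 M r)
    refine ⟨Fin (M + 1) × Ω, inferInstance, fun x => t x.1 * p x.2,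
      fun x => G.carve v x.1 (F x.2), fun x => mul_nonneg (ht0 _) (hp _), ?_, ?_, ?_, fun u => ?_⟩
    · simp only [Fintype.sum_prod_type, ← Finset.mul_sum, hsum, mul_one]
      exact sum_truncTail_sub q M
    · rintro ⟨r, ω⟩ x w h
      simp only [carve] at h
      split_ifs at h with hr
      · cases h
        exact hr.trans (Nat.lt_succ_iff.1 r.2)
      · exact hdist ω x w h
    · rintro ⟨r, ω⟩ x hx
      simp only [carve]
      split_ifs with hr
      · simp
      · rcases Finset.mem_insert.1 hx with rfl | hx
        · simp at hr
        · exact hcov ω x hx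
    · set d := G.dist v u
      set b := (1 - q ^ (2 * k)) + s.card * q ^ N with hbdef
      have inner (r : ℕ) :
          ∑ ω, p ω * (if G.IsCut k (G.carve v r (F ω)) u then 1 else 0)
            ≤ b * (if r < d - k then 1 else 0)
              + ((if r < d + k then 1 else 0) - (if r < d - k then 1 else 0)) := by
        by_cases hB : r < d + k
        · by_cases hA : r < d - k
          · rw [if_pos hA, if_pos hB, sub_self, add_zero, mul_one]
            refine (Finset.sum_le_sum fun ω _ => ?_).trans (hcut u)
            refine mul_le_mul_of_nonneg_left ?_ (hp ω)
            by_cases hc : G.IsCut k (G.carve v r (F ω)) u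
            · rw [if_pos hc, if_pos (hc.of_carve hG (by omega))]
            · rw [if_neg hc]; split_ifs <;> simp
          · rw [if_neg hA, if_pos hB, mul_zero, zero_add, sub_zero]
            refine (Finset.sum_le_sum fun ω _ => ?_).trans hsum.le
            split_ifs <;> simp [hp ω]
        · rw [if_neg hB, if_neg (by omega : ¬ r < d - k)]
          refine le_of_eq ?_
          simp only [mul_zero, sub_zero, add_zero]
          refine Finset.sum_eq_zero fun ω _ => ?_
          rw [if_neg (not_isCut_carve_of_add_le hG (by omega)), mul_zero]
      have hA := sum_truncTail_sub_lt q M (d - k)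
      have hB := sum_truncTail_sub_lt q M (d + k)
      calc _ = ∑ r : Fin (M + 1), t r *
            ∑ ω, p ω * (if G.IsCut k (G.carve v r (F ω)) u then 1 else 0) := by
            simp only [Fintype.sum_prod_type, Finset.mul_sum, mul_assoc]
        _ ≤ ∑ r : Fin (M + 1), t r * (b * (if (r : ℕ) < d - k then 1 else 0)
              + ((if (r : ℕ) < d + k then 1 else 0) - (if (r : ℕ) < d - k then 1 else 0))) :=
            Finset.sum_le_sum fun r _ => mul_le_mul_of_nonneg_left (inner r) (ht0 r)
        _ = b * (1 - truncTail q M (d - k))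
              + (truncTail q M (d - k) - truncTail q M (d + k)) := by
            have : truncTail q M (d - k) - truncTail q M (d + k)
              = (1 - truncTail q M (d + k)) - (1 - truncTail q M (d - k)) := by ring
            rw [this, ← hA, ← hB, Finset.mul_sum, ← Finset.sum_sub_distrib,
              ← Finset.sum_add_distrib]
            exact Finset.sum_congr rfl fun r _ => by ring
        _ ≤ _ := by
            have hT := truncTail_sub_le h0 h1 (N := N) (k := k) (d := d)
            rw [← hM] at hT
            have hT0 := truncTail_nonneg h0 M (d - k)
            have hsb : 0 ≤ s.card * q ^ N := by positivity
            rw [Finset.card_insert_of_notMem hv]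
            push_cast
            rw [hbdef]
            nlinarith [mul_nonneg hsb hT0]

theorem exists_geometric_parameters {n k : ℕ} (hn : 2 ≤ n) (hk : 1 ≤ k) {ε : ℝ}
    (hε : 0 < ε) (hε1 : ε ≤ 1) (hnε : 1 ≤ ε * n) :
    ∃ (q : ℝ) (N : ℕ), 0 ≤ q ∧ q ≤ 1 ∧ (1 - q ^ (2 * k)) + n * q ^ N ≤ ε ∧
      (2 * (N + 2 * k) : ℝ) ≤ 36 * (k / ε) * Real.log n := by
  have hk' : (1 : ℝ) ≤ k := by exact_mod_cast hk
  have hn' : (2 : ℝ) ≤ n := by exact_mod_cast hn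
  have hlog : 1 / 2 ≤ Real.log n := by
    have := Real.log_two_gt_d9
    have := Real.log_le_log (by norm_num) hn'
    linarith
  set x : ℝ := ε / (4 * k) with hx
  have hx0 : 0 < x := by positivity
  have hxk : x * (4 * k) = ε := by rw [hx]; field_simp
  have hx1 : x ≤ 1 := by nlinarith
  have hy : 4 * (k / ε) = 1 / x := by rw [hx]; field_simp
  refine ⟨1 - x, ⌈3 * Real.log n / x⌉₊, by linarith, by linarith, ?_, ?_⟩
  · have hbern : 1 - 2 * k * x ≤ (1 - x) ^ (2 * k) := by
      have := one_add_mul_le_pow (a := -x) (by linarith) (2 * k)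
      push_cast at this
      rw [← sub_eq_add_neg] at this
      linarith
    have hpow : (1 - x) ^ ⌈3 * Real.log n / x⌉₊ ≤ ((n : ℝ) ^ 3)⁻¹ := by
      have hceil := Nat.le_ceil (3 * Real.log n / x)
      rw [div_le_iff₀ hx0] at hceil
      calc (1 - x) ^ ⌈3 * Real.log n / x⌉₊
          ≤ Real.exp (-x) ^ ⌈3 * Real.log n / x⌉₊ :=
            pow_le_pow_left₀ (by linarith) (Real.one_sub_le_exp_neg x) _
        _ = Real.exp (⌈3 * Real.log n / x⌉₊ * -x) := by rw [Real.exp_nat_mul]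
        _ ≤ Real.exp (-(3 * Real.log n)) := Real.exp_le_exp.2 (by linarith)
        _ = ((n : ℝ) ^ 3)⁻¹ := by
            rw [Real.exp_neg, ← Real.exp_log (show (0 : ℝ) < n by linarith), ← Real.exp_nat_mul,
              Real.log_exp]
            norm_num
    have hmul : n * (1 - x) ^ ⌈3 * Real.log n / x⌉₊ ≤ ε / 2 := by
      refine (mul_le_mul_of_nonneg_left hpow (by positivity)).trans ?_
      rw [← div_eq_mul_inv, div_le_iff₀ (by positivity)]
      nlinarith [mul_le_mul hn' hnε zero_le_one (by linarith), sq_nonneg (n : ℝ)]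
    linarith
  · have hceil := (Nat.ceil_lt_add_one (a := 3 * Real.log n / x) (by positivity)).le
    have hdiv : 3 * Real.log n / x = 12 * (k / ε) * Real.log n := by
      rw [div_eq_mul_one_div, ← hy]; ring
    have hkε : (k : ℝ) ≤ k / ε := by
      rw [le_div_iff₀ hε]; nlinarith
    rw [hdiv] at hceil
    rw [hdiv]
    nlinarith [mul_le_mul hkε hlog (by norm_num) (by linarith)]

theorem SimpleGraph.Connected.dist_lt_card {V : Type} [Fintype V] {G : SimpleGraph V}
    (hG : G.Connected) (u w : V) : G.dist u w < Fintype.card V := by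
  obtain ⟨p, hp, hlen⟩ := hG.exists_path_of_dist u w
  exact hlen ▸ hp.length_lt

open Classical in
/-- A random colouring whose colour classes have diameter at most `D` and which cuts each
`k`-ball with probability at most `ε` yields a random partition with the same properties. -/
theorem SimpleGraph.exists_pmf_finpartition {V α Ω : Type} [Fintype V] [DecidableEq V]
    [Fintype Ω] (G : SimpleGraph V) {k : ℕ} {ε D : ℝ} (p : Ω → ℝ) (F : Ω → V → α)
    (hp : ∀ ω, 0 ≤ p ω) (hsum : ∑ ω, p ω = 1)
    (hdiam : ∀ ω u w, F ω u = F ω w → (G.dist u w : ℝ) ≤ D)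
    (hcut : ∀ u, ∑ ω, p ω * (if G.IsCut k (F ω) u then 1 else 0) ≤ ε) :
    ∃ μ : PMF (Finpartition (Finset.univ : Finset V)),
      μ.support.Finite ∧
      (∀ P ∈ μ.support, ∀ C ∈ P.parts, ∀ u ∈ C, ∀ w ∈ C, (G.dist u w : ℝ) ≤ D) ∧
      (∀ u : V, ENNReal.ofReal (1 - ε) ≤
        μ.toOuterMeasure {P | ∃ C ∈ P.parts, ∀ w : V, G.dist u w ≤ k → w ∈ C}) := by
  let ν : PMF Ω := PMF.ofFintype (fun ω => ENNReal.ofReal (p ω)) (by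
    rw [← ENNReal.ofReal_sum_of_nonneg fun ω _ => hp ω, hsum, ENNReal.ofReal_one])
  let Φ : Ω → Finpartition (Finset.univ : Finset V) := fun ω =>
    Finpartition.ofSetoid (Setoid.ker (F ω))
  refine ⟨ν.map Φ, Set.toFinite _, ?_, fun u => ?_⟩
  · intro P hP C hC u hu w hw
    obtain ⟨ω, -, rfl⟩ := (PMF.mem_support_map_iff _ _ _).1 hP
    refine hdiam ω u w ?_
    have hw' : w ∈ (Φ ω).part u := by rwa [(Φ ω).part_eq_of_mem hC hu]
    exact Finpartition.mem_part_ofSetoid_iff_rel.1 hw'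
  · rw [PMF.toOuterMeasure_map_apply, PMF.toOuterMeasure_apply_fintype]
    calc ENNReal.ofReal (1 - ε)
        ≤ ENNReal.ofReal (∑ ω, p ω * (if G.IsCut k (F ω) u then 0 else 1)) := by
          refine ENNReal.ofReal_le_ofReal ?_
          have hsplit : ∑ ω, p ω * (if G.IsCut k (F ω) u then 0 else 1)
              = ∑ ω, p ω - ∑ ω, p ω * (if G.IsCut k (F ω) u then 1 else 0) := by
            rw [← Finset.sum_sub_distrib]
            refine Finset.sum_congr rfl fun ω _ => ?_
            split_ifs <;> ring
          linarith [hcut u]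
      _ = ∑ ω, ENNReal.ofReal (p ω * (if G.IsCut k (F ω) u then 0 else 1)) := by
          refine ENNReal.ofReal_sum_of_nonneg fun ω _ => mul_nonneg (hp ω) ?_
          split_ifs <;> simp
      _ ≤ _ := by
          refine Finset.sum_le_sum fun ω _ => ?_
          by_cases hc : G.IsCut k (F ω) u
          · simp [hc]
          · rw [if_neg hc, mul_one, Set.indicator_of_mem]
            · exact le_rfl
            · refine ⟨(Φ ω).part u, (Φ ω).part_mem.2 (Finset.mem_univ u), fun w hw => ?_⟩
              refine Finpartition.mem_part_ofSetoid_iff_rel.2 ?_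
              by_contra hne
              exact hc ⟨w, hw, fun h => hne h.symm⟩


/-- There is a universal constant `c > 0` such that every finite connected
simple graph on `n ≥ 2` vertices admits, for every `k ≥ 1` and `0 < ε ≤ 1`, a finitely
supported probability distribution over partitions of the vertex set (a `(k,ε)`-padded
decomposition): every cluster of every partition in the support has diameter at most
`c·(k/ε)·log n`, and for every vertex `u`, with probability at least `1 - ε` the sampled
partition has a cluster containing the whole ball `B(u,k)`. -/
theorem padded_decomposition_exists :
    ∃ c : ℝ, 0 < c ∧
      ∀ (V : Type) [Fintype V] [DecidableEq V] (G : SimpleGraph V),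
        G.Connected → 2 ≤ Fintype.card V →
        ∀ k : ℕ, 1 ≤ k → ∀ ε : ℝ, 0 < ε → ε ≤ 1 →
        ∃ μ : PMF (Finpartition (Finset.univ : Finset V)),
          μ.support.Finite ∧
          (∀ P ∈ μ.support, ∀ C ∈ P.parts, ∀ u ∈ C, ∀ w ∈ C,
            (G.dist u w : ℝ) ≤ c * ((k : ℝ) / ε) * Real.log (Fintype.card V)) ∧
          (∀ u : V,
            ENNReal.ofReal (1 - ε) ≤
              μ.toOuterMeasure {P | ∃ C ∈ P.parts, ∀ w : V, G.dist u w ≤ k → w ∈ C}) := by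
  classical
  refine ⟨36, by norm_num, ?_⟩
  intro V _ _ G hG hn k hk ε hε hε1
  by_cases hnε : 1 ≤ ε * Fintype.card V
  · obtain ⟨q, N, h0, h1, hq, hN⟩ := exists_geometric_parameters hn hk hε hε1 hnε
    obtain ⟨Ω, _, p, F, hp, hsum, hdist, hcov, hcut⟩ :=
      G.exists_random_carving hG h0 h1 N k Finset.univ
    refine G.exists_pmf_finpartition p F hp hsum (fun ω u w h => le_trans ?_ hN)
      (fun u => (hcut u).trans (by simpa using hq))
    obtain ⟨v, hv⟩ := Option.ne_none_iff_exists'.1 (hcov ω u (Finset.mem_univ u))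
    have hu := hdist ω v u hv
    have hw := hdist ω v w (h ▸ hv)
    have htri := hG.dist_triangle (u := u) (v := v) (w := w)
    rw [G.dist_comm (u := u) (v := v)] at htri
    exact_mod_cast (by omega : G.dist u w ≤ 2 * (N + 2 * k))
  · refine G.exists_pmf_finpartition (fun _ : Unit => 1) (fun _ _ => ()) (by simp) (by simp)
      (fun _ u w _ => ?_) (fun u => by simpa [SimpleGraph.IsCut] using hε.le)
    have hk' : (1 : ℝ) ≤ k := by exact_mod_cast hk
    have hn' : (2 : ℝ) ≤ Fintype.card V := by exact_mod_cast hn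
    have hlog : 1 / 2 ≤ Real.log (Fintype.card V) := by
      have := Real.log_two_gt_d9
      have := Real.log_le_log (by norm_num) hn'
      linarith
    have hd : (G.dist u w : ℝ) ≤ Fintype.card V := by exact_mod_cast (hG.dist_lt_card u w).le
    have hc : (Fintype.card V : ℝ) ≤ k / ε := by
      rw [le_div_iff₀ hε]; linarith
    nlinarith [mul_le_mul hc hlog (by norm_num) (by positivity)]
end

section
/- Let n ≥ 2 be an integer, let b ≥ 0 be a real, and let a, q : ℕ → ℝ satisfy: a_t ≥ 0 for all t; 1/n ≤ q_t ≤ 1 for all t; a_{n−1} = 0; and a_t ≤ (n/(n−1))·(q_t·b + (1 − q_t)·a_{t+1}) for every integer t with 0 ≤ t ≤ n−2. Then a_t ≤ (2 − t/(n−1))·b for every integer t with 0 ≤ t ≤ n−1. -/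
/-- One backward step of the recursion: averaging `b` and `(2 - s) * b` with weight
`p ≥ 1 / n` on `b`, and rescaling by `n / (n - 1)`, gives at most `(2 - s + 1 / (n - 1)) * b`. -/
theorem recursion_step {n p s b : ℝ} (hn : 1 < n) (hp : 1 / n ≤ p) (hs : s ≤ 1) (hb : 0 ≤ b) :
    n / (n - 1) * (p * b + (1 - p) * ((2 - s) * b)) ≤ (2 - s + 1 / (n - 1)) * b := by
  have hd : 0 < n - 1 := by linarith
  have hnp : 1 ≤ n * p := by
    rw [div_le_iff₀ (by linarith)] at hp
    linarith
  have key : 0 ≤ (n * p - 1) * (1 - s) * b :=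
    mul_nonneg (mul_nonneg (by linarith) (by linarith)) hb
  rw [div_mul_eq_mul_div, div_le_iff₀ hd]
  have hrhs : (2 - s + 1 / (n - 1)) * b * (n - 1) = ((2 - s) * (n - 1) + 1) * b := by
    field_simp
  rw [hrhs]
  linarith

/-- The real-valued inductive inequality underlying the proof of
Lemma 3.2: if `a (n-1) = 0`, each `a t ≥ 0`, each `q t ∈ [1/n, 1]`, and
`a t ≤ (n/(n-1))·(q t · b + (1 - q t) · a (t+1))` for `0 ≤ t ≤ n-2`, then
`a t ≤ (2 - t/(n-1))·b` for all `0 ≤ t ≤ n-1`. -/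
theorem recursion_bound (n : ℕ) (hn : 2 ≤ n) (b : ℝ) (hb : 0 ≤ b) (a q : ℕ → ℝ)
    (ha : ∀ t, 0 ≤ a t)
    (hq : ∀ t, 1 / (n : ℝ) ≤ q t ∧ q t ≤ 1)
    (hlast : a (n - 1) = 0)
    (hrec : ∀ t : ℕ, t ≤ n - 2 →
      a t ≤ ((n : ℝ) / ((n : ℝ) - 1)) * (q t * b + (1 - q t) * a (t + 1))) :
    ∀ t : ℕ, t ≤ n - 1 → a t ≤ (2 - (t : ℝ) / ((n : ℝ) - 1)) * b := by
  have hn' : (2 : ℝ) ≤ n := by exact_mod_cast hn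
  have hd : (0 : ℝ) < (n : ℝ) - 1 := by linarith
  have hcast : ((n - 1 : ℕ) : ℝ) = (n : ℝ) - 1 := by
    rw [Nat.cast_sub (by omega), Nat.cast_one]
  intro t ht
  induction ht using Nat.decreasingInduction with
  | self =>
    rw [hlast, hcast, div_self hd.ne']
    linarith
  | of_succ t ht ih =>
    have hs : ((t + 1 : ℕ) : ℝ) / ((n : ℝ) - 1) ≤ 1 := by
      rw [div_le_one hd, ← hcast]
      exact_mod_cast ht
    calc a t ≤ (n : ℝ) / ((n : ℝ) - 1) * (q t * b + (1 - q t) * a (t + 1)) :=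
          hrec t (by omega)
      _ ≤ (n : ℝ) / ((n : ℝ) - 1) *
          (q t * b + (1 - q t) * ((2 - ((t + 1 : ℕ) : ℝ) / ((n : ℝ) - 1)) * b)) := by
          have hq' : 0 ≤ 1 - q t := sub_nonneg.2 (hq t).2
          gcongr
      _ ≤ (2 - ((t + 1 : ℕ) : ℝ) / ((n : ℝ) - 1) + 1 / ((n : ℝ) - 1)) * b :=
          recursion_step (by linarith) (hq t).1 hs hb
      _ = (2 - (t : ℝ) / ((n : ℝ) - 1)) * b := by
          push_cast
          ring
end
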